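/- arXiv:1806.05589 — 2 statements merged into one kernel-verified Lean document; each statement's English description precedes it below -/
import Mathlib

section
/- Let 𝒳, 𝒴 be finite sets with |𝒳| ≥ 2 and |𝒴| ≥ 2, let n ≥ 27, let M be a finitely supported random variable, 𝐗 a random variable on 𝒳^n, and let w, w̃ ∈ 𝒫(𝒴|𝒳) with outputs 𝐘_w, 𝐘_{w̃} of 𝐗 through w^n and w̃^n respectively, satisfying M ⊸ 𝐗 ⊸ 𝐘_w and M ⊸ 𝐗 ⊸ 𝐘_{w̃}. Let δ, α > 0 and ε > (2|𝒳||𝒴|/n)·log₂ n. If Pr( |h(𝐘_{w̃}|M) − H(𝐘_{w̃}|M)| > nδ ) < 2^{−nα} and sup{ D_{ŵ}(w‖w̃|p̂) : ŵ ∈ 𝒫(𝒴|𝒳), p̂ a pmf on 𝒳 } ≤ ε − (2|𝒳||𝒴|/n)·log₂ n, then Pr( |h(𝐘_w|M) − H(𝐘_w|M)| > nδ̃ ) < 2^{−nε} + 2^{−n(α−ε)}, where δ̃ = (2 + 2^{−nε} + 2^{−n(α−ε)})·(δ+ε) + (2^{−nε} + 2^{−n(α−ε)})·(log₂|𝒴|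 − (2/n)·log₂(2^{−nε} + 2^{−n(α−ε)})). -/
open scoped Classical BigOperators

noncomputable section

namespace Paper

variable {Ω : Type*}

/-- Probability of an event under a discrete probability distribution. -/
def pr (μ : PMF Ω) (E : Set Ω) : ℝ := (μ.toOuterMeasure E).toReal

/-- Conditional probability `Pr(E | F)`. -/
def cpr (μ : PMF Ω) (E F : Set Ω) : ℝ := pr μ (E ∩ F) / pr μ F

/-- Entropy spectrum frequency `h_X(x) = -log₂ Pr(X = x)`. -/
def hs {α : Type*} (μ : PMF Ω) (X : Ω → α) (x : α) : ℝ :=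
  - Real.logb 2 (pr μ {ω | X ω = x})

/-- Conditional entropy spectrum frequency `h_{X|Y}(x|y) = -log₂ Pr(X = x | Y = y)`. -/
def hcs {α β : Type*} (μ : PMF Ω) (X : Ω → α) (Y : Ω → β) (x : α) (y : β) : ℝ :=
  - Real.logb 2 (cpr μ {ω | X ω = x} {ω | Y ω = y})

/-- Conditional Shannon entropy (bits) `H(X|Y)`. -/
def Hc {α β : Type*} [Fintype α] [Fintype β] (μ : PMF Ω) (X : Ω → α) (Y : Ω → β) : ℝ :=
  - ∑ x : α, ∑ y : β, pr μ ({ω | X ω = x} ∩ {ω | Y ω = y}) *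
      Real.logb 2 (cpr μ {ω | X ω = x} {ω | Y ω = y})

/-- Shannon entropy (bits) of `X` conditioned on the event `E`. -/
def HEvt {α : Type*} [Fintype α] (μ : PMF Ω) (X : Ω → α) (E : Set Ω) : ℝ :=
  - ∑ x : α, cpr μ {ω | X ω = x} E * Real.logb 2 (cpr μ {ω | X ω = x} E)

/-- Conditional Shannon entropy (bits) `H(X|Y)` computed given the event `E`. -/
def HcEvt {α β : Type*} [Fintype α] [Fintype β] (μ : PMF Ω) (X : Ω → α) (Y : Ω → β)
    (E : Set Ω) : ℝ :=
  - ∑ x : α, ∑ y : β, cpr μ ({ω | X ω = x} ∩ {ω | Y ω = y}) E *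
      Real.logb 2 (cpr μ {ω | X ω = x} ({ω | Y ω = y} ∩ E))

/-- `A ⊸ B ⊸ C` : `A` and `C` are conditionally independent given `B`. -/
def Markov {α β γ : Type*} (μ : PMF Ω) (A : Ω → α) (B : Ω → β) (C : Ω → γ) : Prop :=
  ∀ a b c, pr μ {ω | A ω = a ∧ B ω = b ∧ C ω = c} * pr μ {ω | B ω = b} =
    pr μ {ω | A ω = a ∧ B ω = b} * pr μ {ω | B ω = b ∧ C ω = c}

/-- A discrete memoryless channel from `𝒳` to `𝒴`. -/
structure Channel (𝒳 𝒴 : Type*) [Fintype 𝒴] where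
  w : 𝒳 → 𝒴 → ℝ
  nonneg : ∀ x y, 0 ≤ w x y
  sum_one : ∀ x, ∑ y, w x y = 1

/-- The `n`-fold product channel `W^n(𝐲|𝐱)`. -/
def Channel.pn {𝒳 𝒴 : Type*} [Fintype 𝒴] (W : Channel 𝒳 𝒴) (n : ℕ)
    (x : Fin n → 𝒳) (y : Fin n → 𝒴) : ℝ := ∏ i, W.w (x i) (y i)

/-- `Y` is an output of `X` through `W^n`. -/
def IsOutput {𝒳 𝒴 : Type*} [Fintype 𝒴] {n : ℕ} (μ : PMF Ω)
    (X : Ω → Fin n → 𝒳) (Y : Ω → Fin n → 𝒴) (W : Channel 𝒳 𝒴) : Prop :=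
  ∀ x y, 0 < pr μ {ω | X ω = x} → cpr μ {ω | Y ω = y} {ω | X ω = x} = W.pn n x y

/-- `W^n(B|𝐱)`. -/
def imgMass {𝒳 𝒴 : Type*} [Fintype 𝒴] (W : Channel 𝒳 𝒴) (n : ℕ)
    (x : Fin n → 𝒳) (B : Finset (Fin n → 𝒴)) : ℝ := ∑ y ∈ B, W.pn n x y

/-- `B` is an `η`-image of `A` by `W`. -/
def IsImage {𝒳 𝒴 : Type*} [Fintype 𝒴] (W : Channel 𝒳 𝒴) (n : ℕ)
    (A : Set (Fin n → 𝒳)) (η : ℝ) (B : Finset (Fin n → 𝒴)) : Prop :=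
  ∀ x ∈ A, η ≤ imgMass W n x B

/-- Minimum cardinality of an `η`-image of `A` by `W`. -/
def gimg {𝒳 𝒴 : Type*} [Fintype 𝒴] (W : Channel 𝒳 𝒴) (n : ℕ)
    (A : Set (Fin n → 𝒳)) (η : ℝ) : ℕ :=
  sInf {k | ∃ B : Finset (Fin n → 𝒴), IsImage W n A η B ∧ B.card = k}

/-- `B` is an `η`-quasi-image of the pmf `P` by `W`. -/
def IsQImage {𝒳 𝒴 : Type*} [Fintype 𝒳] [Fintype 𝒴] (W : Channel 𝒳 𝒴) (n : ℕ)
    (P : (Fin n → 𝒳) → ℝ) (η : ℝ) (B : Finset (Fin n → 𝒴)) : Prop :=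
  η ≤ ∑ x, imgMass W n x B * P x

/-- Minimum cardinality of an `η`-quasi-image of `P` by `W`. -/
def gqimg {𝒳 𝒴 : Type*} [Fintype 𝒳] [Fintype 𝒴] (W : Channel 𝒳 𝒴) (n : ℕ)
    (P : (Fin n → 𝒳) → ℝ) (η : ℝ) : ℕ :=
  sInf {k | ∃ B : Finset (Fin n → 𝒴), IsQImage W n P η B ∧ B.card = k}

/-- The number of values in the support of `U`. -/
def suppCard {α : Type*} [Fintype α] (μ : PMF Ω) (U : Ω → α) : ℕ :=
  (Finset.univ.filter (fun u => 0 < pr μ {ω | U ω = u})).card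

/-- Mutual information (bits). -/
def MI {α β : Type*} [Fintype α] [Fintype β] (μ : PMF Ω) (A : Ω → α) (B : Ω → β) : ℝ :=
  ∑ a : α, ∑ b : β, pr μ {ω | A ω = a ∧ B ω = b} *
    Real.logb 2 (pr μ {ω | A ω = a ∧ B ω = b} / (pr μ {ω | A ω = a} * pr μ {ω | B ω = b}))

/-- Conditional mutual information (bits). -/
def CMI {α β γ : Type*} [Fintype α] [Fintype β] [Fintype γ] (μ : PMF Ω)
    (A : Ω → α) (B : Ω → β) (C : Ω → γ) : ℝ :=
  ∑ c : γ, pr μ {ω | C ω = c} * ∑ a : α, ∑ b : β,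
    cpr μ {ω | A ω = a ∧ B ω = b} {ω | C ω = c} *
      Real.logb 2 (cpr μ {ω | A ω = a ∧ B ω = b} {ω | C ω = c} /
        (cpr μ {ω | A ω = a} {ω | C ω = c} * cpr μ {ω | B ω = b} {ω | C ω = c}))

/-- `D_{wh}(w‖w'|p̂)` in the extended reals, with the stated conventions. -/
def Dkl {𝒳 𝒴 : Type*} [Fintype 𝒳] [Fintype 𝒴] (w w' wh : Channel 𝒳 𝒴)
    (p : 𝒳 → ℝ) : EReal :=
  if ∃ x y, 0 < wh.w x y * p x ∧ w'.w x y = 0 ∧ 0 < w.w x y then ⊤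
  else if ∃ x y, 0 < wh.w x y * p x ∧ w.w x y = 0 ∧ 0 < w'.w x y then ⊥
  else ((∑ x : 𝒳, ∑ y : 𝒴, wh.w x y * p x * Real.logb 2 (w.w x y / w'.w x y) : ℝ) : EReal)

/-- `sup { D_{wh}(w‖w'|p̂) }` over channels `wh` and pmfs `p̂` on `𝒳`. -/
def DklSup {𝒳 𝒴 : Type*} [Fintype 𝒳] [Fintype 𝒴] (w w' : Channel 𝒳 𝒴) : EReal :=
  sSup {d : EReal | ∃ (wh : Channel 𝒳 𝒴) (p : 𝒳 → ℝ),
    (∀ x, 0 ≤ p x) ∧ (∑ x, p x = 1) ∧ d = Dkl w w' wh p}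
section SpectrumTransfer

variable {ι : Type*}

/-- Conditional entropy spectrum value attached to a joint mass `p i` and a marginal mass `s i`. -/
def spec (p s : ι → ℝ) (i : ι) : ℝ := -Real.logb 2 (p i / s i)

lemma logb_two_le {t : ℝ} (ht : 0 < t) : Real.logb 2 t ≤ (t - 1) / Real.log 2 := by
  rw [Real.logb]
  exact div_le_div_of_nonneg_right (Real.log_le_sub_one_of_pos ht) (Real.log_nonneg (by norm_num))

lemma spec_nonneg {p s : ι → ℝ} (hp : ∀ i, 0 ≤ p i) (hps : ∀ i, p i ≤ s i) (i : ι) :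
    0 ≤ spec p s i := by
  rw [spec, neg_nonneg]
  exact Real.logb_nonpos (by norm_num) (div_nonneg (hp i) ((hp i).trans (hps i)))
    (div_le_one_of_le₀ (hps i) ((hp i).trans (hps i)))

lemma sum_mul_spec_le {p s : ι → ℝ} (hp : ∀ i, 0 ≤ p i) (hps : ∀ i, p i ≤ s i)
    (B : Finset ι) {N : ℝ} (hN : 0 < N) (hs : ∑ i ∈ B, s i ≤ N) :
    ∑ i ∈ B, p i * spec p s i ≤
      (∑ i ∈ B, p i) * Real.logb 2 N - (∑ i ∈ B, p i) * Real.logb 2 (∑ i ∈ B, p i) := by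
  set P := ∑ i ∈ B, p i with hP
  have hP0 : 0 ≤ P := Finset.sum_nonneg fun i _ => hp i
  rcases hP0.eq_or_lt with h0 | hpos
  · have hz : ∀ i ∈ B, p i = 0 := (Finset.sum_eq_zero_iff_of_nonneg fun i _ => hp i).1 h0.symm
    rw [← h0, Finset.sum_eq_zero fun i hi => by rw [hz i hi, zero_mul]]
    simp
  have hl2 : 0 < Real.log 2 := Real.log_pos (by norm_num)
  have key : ∀ i ∈ B, p i * spec p s i ≤
      (s i * (P / N) - p i) / Real.log 2 + p i * (Real.logb 2 N - Real.logb 2 P) := by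
    intro i _
    rcases (hp i).eq_or_lt with h | h
    · rw [← h]
      have : 0 ≤ s i := (hp i).trans (hps i)
      simp only [zero_mul, sub_zero, add_zero]
      positivity
    · have hsi : 0 < s i := h.trans_le (hps i)
      have h1 : spec p s i =
          Real.logb 2 (s i * (P / N) / p i) + (Real.logb 2 N - Real.logb 2 P) := by
        rw [spec, Real.logb_div h.ne' hsi.ne', Real.logb_div (by positivity) h.ne',
          Real.logb_mul hsi.ne' (by positivity), Real.logb_div hpos.ne' hN.ne']
        ring
      have h2 := logb_two_le (t := s i * (P / N) / p i) (by positivity)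
      have h3 : p i * ((s i * (P / N) / p i - 1) / Real.log 2) =
          (s i * (P / N) - p i) / Real.log 2 := by
        field_simp
      rw [h1, mul_add, ← h3]
      gcongr
  refine (Finset.sum_le_sum key).trans ?_
  rw [Finset.sum_add_distrib, ← Finset.sum_div, Finset.sum_sub_distrib, ← Finset.sum_mul,
    ← Finset.sum_mul, ← hP]
  have h4 : (∑ i ∈ B, s i) * (P / N) - P ≤ 0 := by
    have : (∑ i ∈ B, s i) * (P / N) ≤ N * (P / N) := by gcongr
    rw [mul_div_cancel₀ _ hN.ne'] at this
    linarith
  have h5 := div_nonpos_of_nonpos_of_nonneg h4 hl2.le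
  linarith

lemma neg_mul_logb_le {P η E : ℝ} (hP : 0 ≤ P) (hPη : P ≤ η) (hη : η ≤ 1) (hE : 2 ≤ E) :
    -(P * Real.logb 2 P) ≤ η * E - η * Real.logb 2 η := by
  have hlη : Real.logb 2 η ≤ 0 := Real.logb_nonpos (by norm_num) (hP.trans hPη) hη
  have hη0 : 0 ≤ η := hP.trans hPη
  rcases hP.eq_or_lt with h | h
  · rw [← h]
    nlinarith
  have hl2 : 1 / 2 < Real.log 2 := by linarith [Real.log_two_gt_d9]
  have hηpos : 0 < η := h.trans_le hPη
  have h1 := logb_two_le (t := η / P) (by positivity)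
  rw [Real.logb_div hηpos.ne' h.ne'] at h1
  have h2 : P * ((η / P - 1) / Real.log 2) = (η - P) / Real.log 2 := by field_simp
  have h3 : (η - P) / Real.log 2 ≤ 2 * (η - P) := by
    rw [div_le_iff₀ (by linarith)]
    nlinarith
  have h4 := mul_le_mul_of_nonneg_left h1 h.le
  nlinarith

lemma abs_spec_sub_spec_le {p q s : ι → ℝ} {E : ℝ} {i : ι} (hp : 0 < p i) (hps : p i ≤ s i)
    (hpq : p i ≤ 2 ^ E * q i) (hqp : 2 ^ (-E) * q i ≤ p i) :
    |spec p s i - spec q s i| ≤ E := by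
  have hs : 0 < s i := hp.trans_le hps
  have hE : (0 : ℝ) < 2 ^ E := by positivity
  have hq : 0 < q i := by
    by_contra h
    nlinarith
  have h1 : Real.logb 2 (p i) ≤ E + Real.logb 2 (q i) := by
    have := Real.logb_le_logb_of_le (b := 2) (by norm_num) hp hpq
    rwa [Real.logb_mul hE.ne' hq.ne', Real.logb_rpow (by norm_num) (by norm_num)] at this
  have h2 : -E + Real.logb 2 (q i) ≤ Real.logb 2 (p i) := by
    have := Real.logb_le_logb_of_le (b := 2) (by norm_num) (by positivity) hqp
    rwa [Real.logb_mul (by positivity) hq.ne', Real.logb_rpow (by norm_num) (by norm_num)] at this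
  rw [spec, spec, Real.logb_div hp.ne' hs.ne', Real.logb_div hq.ne' hs.ne', abs_le]
  constructor <;> linarith

variable [Fintype ι]

lemma sum_spec_deviation_lt {p q s : ι → ℝ} (hq : ∀ i, 0 ≤ q i)
    (hps : ∀ i, p i ≤ s i) (hq1 : ∑ i, q i = 1) {D E α Z : ℝ}
    (hpq : ∀ i, p i ≤ 2 ^ E * q i)
    (hstab : ∑ i, (if |spec q s i - Z| > D then q i else 0) < 2 ^ (-α)) :
    ∑ i, (if |spec p s i - Z| > D + E then p i else 0) < 2 ^ (-E) + 2 ^ (-(α - E)) := by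
  have key : ∀ i, (if |spec p s i - Z| > D + E then p i else 0) ≤
      2 ^ (-E) * q i + 2 ^ E * (if |spec q s i - Z| > D then q i else 0) := by
    intro i
    have h1 : 0 ≤ 2 ^ (-E) * q i := mul_nonneg (by positivity) (hq i)
    have h2 : 0 ≤ 2 ^ E * q i := mul_nonneg (by positivity) (hq i)
    by_cases hd : |spec q s i - Z| > D
    · rw [if_pos hd]
      split_ifs
      · linarith [hpq i]
      · positivity
    · rw [if_neg hd, mul_zero, add_zero]
      split_ifs with hb
      · by_contra! hlt
        have h3 := abs_spec_sub_spec_le (h1.trans_lt hlt) (hps i) (hpq i) hlt.le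
        have h4 := abs_sub_le (spec p s i) (spec q s i) Z
        linarith
      · exact h1
  refine (Finset.sum_le_sum fun i _ => key i).trans_lt ?_
  rw [Finset.sum_add_distrib, ← Finset.mul_sum, ← Finset.mul_sum, hq1, mul_one]
  have h5 : (2 : ℝ) ^ (-(α - E)) = 2 ^ E * 2 ^ (-α) := by
    rw [← Real.rpow_add (by norm_num)]
    congr 1
    ring
  rw [h5]
  gcongr

theorem sum_spec_deviation_lt_of_le_mul {p q s : ι → ℝ} (hp : ∀ i, 0 ≤ p i)
    (hq : ∀ i, 0 ≤ q i) (hps : ∀ i, p i ≤ s i) (hqs : ∀ i, q i ≤ s i)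
    (hp1 : ∑ i, p i = 1) (hq1 : ∑ i, q i = 1) {N : ℝ} (hN : 1 ≤ N) (hs : ∑ i, s i = N)
    {D E α η : ℝ} (hD : 0 ≤ D) (hE : 2 ≤ E) (hη : η = 2 ^ (-E) + 2 ^ (-(α - E)))
    (hpq : ∀ i, p i ≤ 2 ^ E * q i)
    (hstab : ∑ i, (if |spec q s i - ∑ j, q j * spec q s j| > D then q i else 0) < 2 ^ (-α)) :
    ∑ i, (if |spec p s i - ∑ j, p j * spec p s j| >
      (2 + η) * (D + E) + η * (Real.logb 2 N - 2 * Real.logb 2 η) then p i else 0) < η := by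
  rcases lt_or_ge 1 η with h1 | h1
  · refine lt_of_le_of_lt (Finset.sum_le_sum fun i _ => ?_) (hp1.trans_lt h1)
    split_ifs
    exacts [le_rfl, hp i]
  have hη0 : 0 < η := by rw [hη]; positivity
  set Hq := ∑ j, q j * spec q s j with hHq
  set Hp := ∑ j, p j * spec p s j with hHp
  have hdev := sum_spec_deviation_lt hq hps hq1 hpq hstab
  rw [← hη, ← Finset.sum_filter] at hdev
  set B := Finset.univ.filter fun i => |spec p s i - Hq| > D + E with hB
  set P := ∑ i ∈ B, p i with hP
  have hP0 : 0 ≤ P := Finset.sum_nonneg fun i _ => hp i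
  have hlogN : 0 ≤ Real.logb 2 N := Real.logb_nonneg (by norm_num) hN
  have hlogη : Real.logb 2 η ≤ 0 := Real.logb_nonpos (by norm_num) hη0.le h1
  have hPlog : P * Real.logb 2 P ≤ 0 := mul_nonpos_of_nonneg_of_nonpos hP0
    (Real.logb_nonpos (by norm_num) hP0 (hdev.le.trans h1))
  have hHq0 : 0 ≤ Hq := Finset.sum_nonneg fun i _ => mul_nonneg (hq i) (spec_nonneg hq hqs i)
  have hHqN : Hq ≤ Real.logb 2 N := by
    have := sum_mul_spec_le hq hqs Finset.univ (by linarith) hs.le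
    rwa [hq1, Real.logb_one, one_mul, one_mul, sub_zero] at this
  have hBs : ∑ i ∈ B, s i ≤ N := hs ▸ Finset.sum_le_sum_of_subset_of_nonneg
    (Finset.subset_univ B) fun i _ _ => (hp i).trans (hps i)
  have hBu : ∑ i ∈ B, p i * spec p s i ≤ P * Real.logb 2 N - P * Real.logb 2 P :=
    sum_mul_spec_le hp hps B (by linarith) hBs
  have hBl : 0 ≤ ∑ i ∈ B, p i * spec p s i :=
    Finset.sum_nonneg fun i _ => mul_nonneg (hp i) (spec_nonneg hp hps i)
  have hsplit : Hp - Hq = ∑ i ∈ Bᶜ, p i * (spec p s i - Hq) +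
      (∑ i ∈ B, p i * spec p s i - P * Hq) := by
    have h2 : Hp - Hq = ∑ i, p i * (spec p s i - Hq) := by
      simp_rw [mul_sub, Finset.sum_sub_distrib, ← Finset.sum_mul, hp1, one_mul]
      rfl
    rw [h2, ← Finset.sum_compl_add_sum B]
    simp_rw [mul_sub, Finset.sum_sub_distrib, ← Finset.sum_mul]
    rfl
  have hG : |∑ i ∈ Bᶜ, p i * (spec p s i - Hq)| ≤ D + E := by
    refine (Finset.abs_sum_le_sum_abs _ _).trans ?_
    have h3 : ∀ i ∈ Bᶜ, |p i * (spec p s i - Hq)| ≤ p i * (D + E) := by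
      intro i hi
      rw [abs_mul, abs_of_nonneg (hp i)]
      refine mul_le_mul_of_nonneg_left ?_ (hp i)
      simpa [hB] using hi
    refine (Finset.sum_le_sum h3).trans ?_
    rw [← Finset.sum_mul]
    have h4 : ∑ i ∈ Bᶜ, p i ≤ 1 := hp1 ▸ Finset.sum_le_sum_of_subset_of_nonneg
      (Finset.subset_univ _) fun i _ _ => hp i
    nlinarith
  have hent := neg_mul_logb_le hP0 hdev.le h1 hE
  have hPN : P * Real.logb 2 N ≤ η * Real.logb 2 N := by gcongr
  have hPH : P * Hq ≤ P * Real.logb 2 N := by gcongr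
  have hPH0 : 0 ≤ P * Hq := by positivity
  have hηlog : η * Real.logb 2 η ≤ 0 := mul_nonpos_of_nonneg_of_nonpos hη0.le hlogη
  have hηD : 0 ≤ η * D := by positivity
  have hdiff : |Hp - Hq| ≤ D + E + (η * Real.logb 2 N + η * E - 2 * (η * Real.logb 2 η)) := by
    rw [abs_le] at hG ⊢
    rw [hsplit]
    constructor <;> linarith [hG.1, hG.2]
  rw [← Finset.sum_filter]
  refine lt_of_le_of_lt (Finset.sum_le_sum_of_subset_of_nonneg ?_ fun i _ _ => hp i) hdev
  intro i hi
  simp only [hB, Finset.mem_filter, Finset.mem_univ, true_and] at hi ⊢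
  have h5 := abs_sub_le (spec p s i) Hq Hp
  rw [abs_sub_comm Hq Hp] at h5
  linarith

end SpectrumTransfer

lemma pr_nonneg (μ : PMF Ω) (S : Set Ω) : 0 ≤ pr μ S := ENNReal.toReal_nonneg

lemma toOuterMeasure_ne_top (μ : PMF Ω) (S : Set Ω) : μ.toOuterMeasure S ≠ ⊤ := by
  refine ne_top_of_le_ne_top ENNReal.one_ne_top ?_
  rw [PMF.toOuterMeasure_apply, ← μ.tsum_coe]
  exact ENNReal.tsum_le_tsum fun a => Set.indicator_le_self _ _ a

lemma pr_mono (μ : PMF Ω) {S T : Set Ω} (h : S ⊆ T) : pr μ S ≤ pr μ T :=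
  ENNReal.toReal_mono (toOuterMeasure_ne_top μ T) (μ.toOuterMeasure.mono h)

lemma pr_univ (μ : PMF Ω) : pr μ Set.univ = 1 := by
  rw [pr, PMF.toOuterMeasure_apply, Set.indicator_univ, μ.tsum_coe, ENNReal.toReal_one]

lemma pr_eq_sum_fiber {κ : Type*} [Fintype κ] (μ : PMF Ω) (Z : Ω → κ) (S : Set Ω) :
    pr μ S = ∑ z, pr μ (S ∩ {ω | Z ω = z}) := by
  simp only [pr]
  rw [← ENNReal.toReal_sum fun z _ => toOuterMeasure_ne_top μ _]
  simp only [PMF.toOuterMeasure_apply]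
  rw [← Summable.tsum_finsetSum fun z _ => ENNReal.summable]
  congr 1
  refine tsum_congr fun ω => ?_
  rw [Finset.sum_eq_single (Z ω)]
  · simp [Set.indicator_apply]
  · intro z _ hz
    simp [hz.symm]
  · simp

lemma pr_setOf_eq_sum {κ : Type*} [Fintype κ] (μ : PMF Ω) (Z : Ω → κ) (Q : κ → Prop) :
    pr μ {ω | Q (Z ω)} = ∑ z, if Q z then pr μ {ω | Z ω = z} else 0 := by
  rw [pr_eq_sum_fiber μ Z]
  refine Finset.sum_congr rfl fun z _ => ?_
  split_ifs with h
  · congr 1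
    ext ω
    simp only [Set.mem_inter_iff, Set.mem_ofPred_eq, and_iff_right_iff_imp]
    rintro rfl
    exact h
  · have : {ω | Q (Z ω)} ∩ {ω | Z ω = z} = ∅ := by
      ext ω
      simp only [Set.mem_inter_iff, Set.mem_ofPred_eq, Set.mem_empty_iff_false, iff_false, not_and]
      rintro hQ rfl
      exact h hQ
    simp [this, pr]

section Output

variable {𝒳 𝒴 𝓜 : Type*} [Fintype 𝒴] {n : ℕ}

lemma Channel.pn_le_rpow_mul {w w' : Channel 𝒳 𝒴} {c : ℝ}
    (h : ∀ x y, w.w x y ≤ 2 ^ c * w'.w x y) (x : Fin n → 𝒳) (y : Fin n → 𝒴) :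
    w.pn n x y ≤ 2 ^ (n * c) * w'.pn n x y := by
  have h1 : (2 : ℝ) ^ (n * c) = ∏ _i : Fin n, (2 : ℝ) ^ c := by
    rw [Finset.prod_const, Finset.card_univ, Fintype.card_fin, ← Real.rpow_natCast,
      ← Real.rpow_mul (by norm_num), mul_comm]
  rw [Channel.pn, Channel.pn, h1, ← Finset.prod_mul_distrib]
  exact Finset.prod_le_prod (fun i _ => w.nonneg _ _) fun i _ => h _ _

variable [Fintype 𝒳]

lemma pr_output_inter_eq_sum (μ : PMF Ω) {M : Ω → 𝓜} {X : Ω → Fin n → 𝒳} {Y : Ω → Fin n → 𝒴}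
    {w : Channel 𝒳 𝒴} (hout : IsOutput μ X Y w) (hmc : Markov μ M X Y)
    (y : Fin n → 𝒴) (m : 𝓜) :
    pr μ ({ω | Y ω = y} ∩ {ω | M ω = m}) =
      ∑ x, pr μ {ω | M ω = m ∧ X ω = x} * w.pn n x y := by
  rw [pr_eq_sum_fiber μ X]
  refine Finset.sum_congr rfl fun x _ => ?_
  have hset : {ω | Y ω = y} ∩ {ω | M ω = m} ∩ {ω | X ω = x} =
      {ω | M ω = m ∧ X ω = x ∧ Y ω = y} := by
    ext ω
    simp only [Set.mem_inter_iff, Set.mem_ofPred_eq]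
    tauto
  rw [hset]
  rcases (pr_nonneg μ {ω | X ω = x}).eq_or_lt with h | h
  · have h1 : pr μ {ω | M ω = m ∧ X ω = x ∧ Y ω = y} = 0 :=
      le_antisymm (h ▸ pr_mono μ fun ω hω => hω.2.1) (pr_nonneg _ _)
    have h2 : pr μ {ω | M ω = m ∧ X ω = x} = 0 :=
      le_antisymm (h ▸ pr_mono μ fun ω hω => hω.2) (pr_nonneg _ _)
    rw [h1, h2, zero_mul]
  · have h1 := hmc m x y
    have h2 := hout x y h
    have h3 : {ω | Y ω = y} ∩ {ω | X ω = x} = {ω | X ω = x ∧ Y ω = y} := by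
      ext ω
      exact and_comm
    rw [cpr, h3, div_eq_iff h.ne'] at h2
    rw [h2, ← mul_assoc] at h1
    exact mul_right_cancel₀ h.ne' h1

lemma pr_output_inter_le (μ : PMF Ω) {M : Ω → 𝓜} {X : Ω → Fin n → 𝒳} {Y Y' : Ω → Fin n → 𝒴}
    {w w' : Channel 𝒳 𝒴} (hout : IsOutput μ X Y w) (hmc : Markov μ M X Y)
    (hout' : IsOutput μ X Y' w') (hmc' : Markov μ M X Y') {c : ℝ}
    (h : ∀ x y, w.w x y ≤ 2 ^ c * w'.w x y) (y : Fin n → 𝒴) (m : 𝓜) :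
    pr μ ({ω | Y ω = y} ∩ {ω | M ω = m}) ≤
      2 ^ (n * c) * pr μ ({ω | Y' ω = y} ∩ {ω | M ω = m}) := by
  rw [pr_output_inter_eq_sum μ hout hmc, pr_output_inter_eq_sum μ hout' hmc', Finset.mul_sum]
  refine Finset.sum_le_sum fun x _ => ?_
  rw [mul_left_comm]
  exact mul_le_mul_of_nonneg_left (Channel.pn_le_rpow_mul h x y) (pr_nonneg _ _)

lemma channel_le_of_DklSup_le {w w' : Channel 𝒳 𝒴} {c : ℝ} (h : DklSup w w' ≤ (c : EReal))
    (x₀ : 𝒳) (y₀ : 𝒴) : w.w x₀ y₀ ≤ 2 ^ c * w'.w x₀ y₀ := by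
  rcases (w.nonneg x₀ y₀).eq_or_lt with h0 | hpos
  · rw [← h0]
    exact mul_nonneg (by positivity) (w'.nonneg _ _)
  let wh : Channel 𝒳 𝒴 :=
    { w := fun _ y => if y = y₀ then 1 else 0
      nonneg := fun x y => by split_ifs <;> norm_num
      sum_one := fun x => by simp }
  let p : 𝒳 → ℝ := fun x => if x = x₀ then 1 else 0
  have hle : Dkl w w' wh p ≤ (c : EReal) := by
    refine le_trans (le_sSup ?_) h
    refine ⟨wh, p, fun x => ?_, by simp [p], rfl⟩
    simp only [p]
    split_ifs <;> norm_num
  have hw' : 0 < w'.w x₀ y₀ := by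
    refine (w'.nonneg x₀ y₀).lt_of_ne' fun hz => ?_
    rw [Dkl, if_pos ⟨x₀, y₀, by simp [wh, p], hz, hpos⟩, top_le_iff] at hle
    exact EReal.coe_ne_top _ hle
  have hsupp : ∀ x y, 0 < wh.w x y * p x → x = x₀ ∧ y = y₀ := by
    intro x y hxy
    constructor
    · by_contra hne
      simp [p, hne] at hxy
    · by_contra hne
      simp [wh, hne] at hxy
  rw [Dkl, if_neg, if_neg, EReal.coe_le_coe_iff] at hle
  · simp [wh, p] at hle
    rw [Real.logb_le_iff_le_rpow (by norm_num) (by positivity), div_le_iff₀ hw'] at hle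
    exact hle
  · rintro ⟨x, y, hxy, hz, -⟩
    obtain ⟨rfl, rfl⟩ := hsupp x y hxy
    exact hpos.ne' hz
  · rintro ⟨x, y, hxy, hz, -⟩
    obtain ⟨rfl, rfl⟩ := hsupp x y hxy
    exact hw'.ne' hz

end Output

section JointMass

variable {α β : Type*}

/-- Joint mass of a pair of random variables. -/
def joint (μ : PMF Ω) (A : Ω → α) (B : Ω → β) (z : α × β) : ℝ :=
  pr μ ({ω | A ω = z.1} ∩ {ω | B ω = z.2})

/-- Mass of the second component, as a function of the pair. -/
def sndMass (μ : PMF Ω) (B : Ω → β) (z : α × β) : ℝ := pr μ {ω | B ω = z.2}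

lemma joint_le_sndMass (μ : PMF Ω) (A : Ω → α) (B : Ω → β) (z : α × β) :
    joint μ A B z ≤ sndMass μ B z := pr_mono μ Set.inter_subset_right

lemma joint_eq (μ : PMF Ω) (A : Ω → α) (B : Ω → β) (z : α × β) :
    joint μ A B z = pr μ {ω | (A ω, B ω) = z} := by
  rw [joint]
  congr 1
  ext ω
  simp [Prod.ext_iff]

variable [Fintype α] [Fintype β]

lemma sum_joint (μ : PMF Ω) (A : Ω → α) (B : Ω → β) : ∑ z, joint μ A B z = 1 := by
  rw [← pr_univ μ, pr_eq_sum_fiber μ (fun ω => (A ω, B ω))]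
  simp_rw [joint_eq, Set.univ_inter]

lemma sum_sndMass (μ : PMF Ω) (B : Ω → β) :
    ∑ z : α × β, sndMass μ B z = Fintype.card α := by
  have h : ∑ b, pr μ {ω | B ω = b} = 1 := by
    rw [← pr_univ μ, pr_eq_sum_fiber μ B]
    simp_rw [Set.univ_inter]
  simp [Fintype.sum_prod_type, sndMass, h]

lemma Hc_eq_sum (μ : PMF Ω) (A : Ω → α) (B : Ω → β) :
    Hc μ A B = ∑ z, joint μ A B z * spec (joint μ A B) (sndMass μ B) z := by
  simp only [Hc, Fintype.sum_prod_type, spec, mul_neg, Finset.sum_neg_distrib]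
  rfl

lemma pr_hcs_deviation (μ : PMF Ω) (A : Ω → α) (B : Ω → β) (T : ℝ) :
    pr μ {ω | |hcs μ A B (A ω) (B ω) - Hc μ A B| > T} =
      ∑ z, if |spec (joint μ A B) (sndMass μ B) z -
        ∑ z', joint μ A B z' * spec (joint μ A B) (sndMass μ B) z'| > T
        then joint μ A B z else 0 := by
  rw [← Hc_eq_sum]
  simp_rw [joint_eq]
  exact pr_setOf_eq_sum μ (fun ω => (A ω, B ω))
    fun z => |spec (joint μ A B) (sndMass μ B) z - Hc μ A B| > T

end JointMass

/-- Lemma `olalt2`. -/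
theorem stability_transfer_between_channels
    (𝒳 𝒴 : Type) [Fintype 𝒳] [Fintype 𝒴]
    (hX : 2 ≤ Fintype.card 𝒳) (hY : 2 ≤ Fintype.card 𝒴)
    (n : ℕ) (hn : 27 ≤ n)
    (Ω : Type) (μ : PMF Ω) (𝓜 : Type) [Fintype 𝓜] (M : Ω → 𝓜)
    (X : Ω → Fin n → 𝒳) (w w' : Channel 𝒳 𝒴) (Yw Yw' : Ω → Fin n → 𝒴)
    (houtw : IsOutput μ X Yw w) (houtw' : IsOutput μ X Yw' w')
    (hmcw : Markov μ M X Yw) (hmcw' : Markov μ M X Yw')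
    (δ α ε : ℝ) (hδ : 0 < δ) (hα : 0 < α)
    (hε : (2 * (Fintype.card 𝒳) * (Fintype.card 𝒴) / n) * Real.logb 2 n < ε)
    (hstab : pr μ {ω | |hcs μ Yw' M (Yw' ω) (M ω) - Hc μ Yw' M| > n * δ} <
      2 ^ (-(n : ℝ) * α))
    (hD : DklSup w w' ≤
      ((ε - (2 * (Fintype.card 𝒳) * (Fintype.card 𝒴) / n) * Real.logb 2 n : ℝ) : EReal)) :
    ∀ δt : ℝ,
      δt = (2 + 2 ^ (-(n : ℝ) * ε) + 2 ^ (-(n : ℝ) * (α - ε))) * (δ + ε) +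
        (2 ^ (-(n : ℝ) * ε) + 2 ^ (-(n : ℝ) * (α - ε))) *
          (Real.logb 2 (Fintype.card 𝒴) -
            (2 / n) * Real.logb 2 (2 ^ (-(n : ℝ) * ε) + 2 ^ (-(n : ℝ) * (α - ε)))) →
      pr μ {ω | |hcs μ Yw M (Yw ω) (M ω) - Hc μ Yw M| > n * δt} <
        2 ^ (-(n : ℝ) * ε) + 2 ^ (-(n : ℝ) * (α - ε)) := by
  intro δt hδt
  have hn0 : (0 : ℝ) < n := by exact_mod_cast (by omega : 0 < n)
  have hX' : (2 : ℝ) ≤ Fintype.card 𝒳 := by exact_mod_cast hX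
  have hY' : (2 : ℝ) ≤ Fintype.card 𝒴 := by exact_mod_cast hY
  have hlog : 1 ≤ Real.logb 2 n := by
    rw [Real.le_logb_iff_rpow_le (by norm_num) hn0, Real.rpow_one]
    exact_mod_cast (by omega : 2 ≤ n)
  have hXY : (4 : ℝ) ≤ Fintype.card 𝒳 * Fintype.card 𝒴 := by nlinarith
  have hr : 0 ≤ (2 * (Fintype.card 𝒳) * (Fintype.card 𝒴) / n) * Real.logb 2 n := by positivity
  have hnε : 2 ≤ n * ε := by
    have h1 := mul_lt_mul_of_pos_left hε hn0
    have h2 : (n : ℝ) * ((2 * (Fintype.card 𝒳) * (Fintype.card 𝒴) / n) * Real.logb 2 n) =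
        2 * (Fintype.card 𝒳 * Fintype.card 𝒴) * Real.logb 2 n := by
      field_simp
    rw [h2] at h1
    nlinarith
  have hch : ∀ x y, w.w x y ≤ 2 ^ ε * w'.w x y :=
    channel_le_of_DklSup_le (hD.trans (EReal.coe_le_coe_iff.2 (by linarith)))
  have hN : (1 : ℝ) ≤ Fintype.card (Fin n → 𝒴) := by
    rw [Fintype.card_fun, Fintype.card_fin, Nat.cast_pow]
    exact one_le_pow₀ (by linarith)
  have hlogN : Real.logb 2 (Fintype.card (Fin n → 𝒴)) = n * Real.logb 2 (Fintype.card 𝒴) := by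
    rw [Fintype.card_fun, Fintype.card_fin, Nat.cast_pow, Real.logb_pow]
  have e1 : -(n : ℝ) * ε = -(n * ε) := by ring
  have e2 : -(n : ℝ) * (α - ε) = -(n * α - n * ε) := by ring
  have e3 : -(n : ℝ) * α = -(n * α) := by ring
  rw [e1, e2] at hδt ⊢
  rw [pr_hcs_deviation, e3] at hstab
  rw [pr_hcs_deviation]
  have key := sum_spec_deviation_lt_of_le_mul (p := joint μ Yw M) (q := joint μ Yw' M)
    (s := sndMass μ M) (fun z => pr_nonneg μ _) (fun z => pr_nonneg μ _)
    (joint_le_sndMass μ Yw M) (joint_le_sndMass μ Yw' M) (sum_joint μ Yw M) (sum_joint μ Yw' M)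
    hN (sum_sndMass μ M) (mul_nonneg hn0.le hδ.le) hnε rfl
    (fun z => pr_output_inter_le μ houtw hmcw houtw' hmcw' hch z.1 z.2) hstab
  have hT : n * δt = (2 + (2 ^ (-(n * ε)) + 2 ^ (-(n * α - n * ε)))) * (n * δ + n * ε) +
      (2 ^ (-(n * ε)) + 2 ^ (-(n * α - n * ε))) *
        (Real.logb 2 (Fintype.card (Fin n → 𝒴)) -
          2 * Real.logb 2 (2 ^ (-(n * ε)) + 2 ^ (-(n * α - n * ε)))) := by
    rw [hδt, hlogN]
    field_simp
    ring
  rw [hT]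
  exact key

end Paper
end
end

section
/- Let 𝒳 and 𝒴 be finite sets with |𝒳| ≥ 2 and |𝒴| ≥ 2, and let ε ∈ (0,1). There exists a set 𝒫^{(ε)} ⊆ 𝒫(𝒴|𝒳) with |𝒫^{(ε)}| ≤ (|𝒴|·(1 + ⌊4|𝒴|²/ε⌋))^{|𝒳||𝒴|} such that for every w ∈ 𝒫(𝒴|𝒳) there exists w̃ ∈ 𝒫^{(ε)} with sup{ D_{ŵ}(w‖w̃|p̂) : ŵ ∈ 𝒫(𝒴|𝒳), p̂ a probability mass function on 𝒳 } ≤ ε/2. -/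
open scoped Classical BigOperators

noncomputable section

namespace Paper

variable {Ω : Type*}

/-- The channel whose rows are the normalized counts `k x y + 1`. -/
def Channel.ofCounts {𝒳 𝒴 : Type*} [Fintype 𝒴] [Nonempty 𝒴] (k : 𝒳 → 𝒴 → ℕ) :
    Channel 𝒳 𝒴 where
  w x y := ((k x y : ℝ) + 1) / ∑ y', ((k x y' : ℝ) + 1)
  nonneg x y := by positivity
  sum_one x := by
    rw [← Finset.sum_div]
    exact div_self (Finset.sum_pos (fun y _ => by positivity) Finset.univ_nonempty).ne'

lemma Channel.ofCounts_pos {𝒳 𝒴 : Type*} [Fintype 𝒴] [Nonempty 𝒴] (k : 𝒳 → 𝒴 → ℕ)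
    (x : 𝒳) (y : 𝒴) : 0 < (Channel.ofCounts k).w x y :=
  div_pos (by positivity) (Finset.sum_pos (fun y _ => by positivity) Finset.univ_nonempty)

lemma Channel.w_le_one {𝒳 𝒴 : Type*} [Fintype 𝒴] (w : Channel 𝒳 𝒴) (x : 𝒳) (y : 𝒴) :
    w.w x y ≤ 1 :=
  w.sum_one x ▸ Finset.single_le_sum (fun y _ => w.nonneg x y) (Finset.mem_univ y)

lemma Channel.div_ofCounts_floor_le {𝒳 𝒴 : Type*} [Fintype 𝒴] [Nonempty 𝒴] (w : Channel 𝒳 𝒴)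
    {N : ℕ} (hN : 0 < N) (x : 𝒳) (y : 𝒴) :
    w.w x y / (Channel.ofCounts fun x y => ⌊N * w.w x y⌋₊).w x y ≤
      1 + (Fintype.card 𝒴 : ℝ) / N := by
  have hN' : (0 : ℝ) < N := by exact_mod_cast hN
  have hw := w.nonneg x y
  rw [div_le_iff₀ (Channel.ofCounts_pos _ x y)]
  have hT : ∑ y', ((⌊N * w.w x y'⌋₊ : ℝ) + 1) ≤ N + Fintype.card 𝒴 := by
    calc ∑ y', ((⌊N * w.w x y'⌋₊ : ℝ) + 1)
        ≤ ∑ y', (N * w.w x y' + 1) := Finset.sum_le_sum fun y' _ => by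
          gcongr
          exact Nat.floor_le (mul_nonneg hN'.le (w.nonneg x y'))
      _ = N + Fintype.card 𝒴 := by
          simp [Finset.sum_add_distrib, ← Finset.mul_sum, w.sum_one x]
  have hpos : 0 < ∑ y', ((⌊N * w.w x y'⌋₊ : ℝ) + 1) :=
    Finset.sum_pos (fun y _ => by positivity) Finset.univ_nonempty
  have hfl := (Nat.lt_floor_add_one (N * w.w x y)).le
  change w.w x y ≤ (1 + (Fintype.card 𝒴 : ℝ) / N) *
    (((⌊N * w.w x y⌋₊ : ℝ) + 1) / ∑ y', ((⌊N * w.w x y'⌋₊ : ℝ) + 1))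
  rw [mul_div_assoc', le_div_iff₀ hpos]
  calc w.w x y * ∑ y', ((⌊N * w.w x y'⌋₊ : ℝ) + 1)
      ≤ w.w x y * (N + Fintype.card 𝒴) := by gcongr
    _ = (1 + (Fintype.card 𝒴 : ℝ) / N) * (N * w.w x y) := by field_simp
    _ ≤ _ := by gcongr

/-- A pointwise bound on the log-likelihood ratio bounds every divergence `Dkl w w' wh p`. -/
lemma DklSup_le_of_logb_le {𝒳 𝒴 : Type*} [Fintype 𝒳] [Fintype 𝒴] {w w' : Channel 𝒳 𝒴} {c : ℝ}
    (hpos : ∀ x y, 0 < w'.w x y) (h : ∀ x y, Real.logb 2 (w.w x y / w'.w x y) ≤ c) :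
    DklSup w w' ≤ (c : EReal) := by
  refine sSup_le ?_
  rintro _ ⟨wh, p, hp, hp1, rfl⟩
  unfold Dkl
  rw [if_neg (by rintro ⟨x, y, -, h0, -⟩; exact (hpos x y).ne' h0)]
  split_ifs
  · exact bot_le
  · rw [EReal.coe_le_coe_iff]
    calc ∑ x, ∑ y, wh.w x y * p x * Real.logb 2 (w.w x y / w'.w x y)
        ≤ ∑ x, ∑ y, wh.w x y * p x * c :=
          Finset.sum_le_sum fun x _ => Finset.sum_le_sum fun y _ =>
            mul_le_mul_of_nonneg_left (h x y) (mul_nonneg (wh.nonneg x y) (hp x))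
      _ = c := by simp [← Finset.sum_mul, wh.sum_one, hp1]

lemma logb_two_le_two_mul {r t : ℝ} (hr : 0 ≤ r) (ht : 0 ≤ t) (h : r ≤ 1 + t) :
    Real.logb 2 r ≤ 2 * t := by
  rcases hr.eq_or_lt with rfl | hr
  · simpa using ht
  have h2 : (0.6931471803 : ℝ) < Real.log 2 := Real.log_two_gt_d9
  rw [Real.logb, div_le_iff₀ (by linarith)]
  nlinarith [Real.log_le_sub_one_of_pos hr]

/-- approximating set of channels. -/
theorem exists_channel_approximating_set
    (𝒳 𝒴 : Type) [Fintype 𝒳] [Fintype 𝒴]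
    (hX : 2 ≤ Fintype.card 𝒳) (hY : 2 ≤ Fintype.card 𝒴)
    (ε : ℝ) (hε0 : 0 < ε) (hε1 : ε < 1) :
    ∃ S : Set (Channel 𝒳 𝒴), S.Finite ∧
      S.ncard ≤
        ((Fintype.card 𝒴) * (1 + ⌊4 * (Fintype.card 𝒴 : ℝ) ^ 2 / ε⌋₊)) ^
          ((Fintype.card 𝒳) * (Fintype.card 𝒴)) ∧
      ∀ w : Channel 𝒳 𝒴, ∃ w' ∈ S, DklSup w w' ≤ ((ε / 2 : ℝ) : EReal) := by
  have : Nonempty 𝒴 := Fintype.card_pos_iff.mp (by omega)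
  set n := Fintype.card 𝒴 with hn
  have hn2 : (2 : ℝ) ≤ n := by exact_mod_cast hY
  set N := ⌊4 * (n : ℝ) ^ 2 / ε⌋₊ with hNdef
  have hNlt : 4 * (n : ℝ) ^ 2 / ε < N + 1 := Nat.lt_floor_add_one _
  rw [div_lt_iff₀ hε0] at hNlt
  have hNε : 4 * (n : ℝ) ≤ N * ε := by nlinarith
  have hNR : (0 : ℝ) < N := by
    by_contra! h
    nlinarith
  have hN : 0 < N := by exact_mod_cast hNR
  refine ⟨Set.range fun k : 𝒳 → 𝒴 → Fin (N + 1) => Channel.ofCounts fun x y => (k x y : ℕ),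
    Set.finite_range _, ?_, fun w => ⟨_, ⟨fun x y => ⟨⌊N * w.w x y⌋₊, ?_⟩, rfl⟩, ?_⟩⟩
  · rw [← Set.image_univ]
    refine (Set.ncard_image_le Set.finite_univ).trans ?_
    rw [Set.ncard_univ, Nat.card_eq_fintype_card]
    simp only [Fintype.card_fun, Fintype.card_fin, ← hn]
    rw [← pow_mul, mul_comm n (Fintype.card 𝒳)]
    exact Nat.pow_le_pow_left (by nlinarith) _
  · rw [Nat.lt_succ_iff]
    exact Nat.floor_le_of_le (mul_le_of_le_one_right hNR.le (w.w_le_one x y))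
  · refine DklSup_le_of_logb_le (fun x y => Channel.ofCounts_pos _ x y) fun x y => ?_
    refine (logb_two_le_two_mul
      (div_nonneg (w.nonneg x y) (Channel.ofCounts_pos _ x y).le) (by positivity)
      (w.div_ofCounts_floor_le hN x y)).trans ?_
    rw [mul_div_assoc', div_le_iff₀ hNR]
    nlinarith

end Paper
end
end
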